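/- Let G be a finite subgroup of GL(2, ℂ) acting on the polynomial ring ℂ[x, y] such that no element of G other than the identity has 1 as an eigenvalue (the action is free in codimension 1). For m ∈ ℕ let d_m be the dimension of the space of G-invariant polynomials of degree < m. Then for every m divisible by |G|, d_m + d_{m+1} = ((m+1)^2 + |G| − 1)/|G|. -/

import Mathlib

open MvPolynomial

/-- The algebra endomorphism of `ℂ[x,y]` induced by linear substitution by a matrix. -/
noncomputable def actPoly (M : Matrix (Fin 2) (Fin 2) ℂ) :
    MvPolynomial (Fin 2) ℂ →ₐ[ℂ] MvPolynomial (Fin 2) ℂ :=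
  bind₁ (fun i => ∑ j : Fin 2, C (M i j) * X j)

/-- Invariant polynomials of a subgroup `G ⊂ GL(2,ℂ)`. -/
noncomputable def invPoly (G : Subgroup (GL (Fin 2) ℂ)) :
    Submodule ℂ (MvPolynomial (Fin 2) ℂ) :=
  ⨅ g ∈ G, LinearMap.ker ((actPoly (g : Matrix (Fin 2) (Fin 2) ℂ)).toLinearMap - LinearMap.id)

/-- The dimension `d_m` of the space of `G`-invariant polynomials of total degree `< m`. -/
noncomputable def dInv (G : Subgroup (GL (Fin 2) ℂ)) (m : ℕ) : ℕ :=
  Module.finrank ℂ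
    ↥(invPoly G ⊓ ⨆ i ∈ Finset.range m, homogeneousSubmodule (Fin 2) ℂ i)

open Matrix in
/-- A complex matrix of finite order is diagonalizable. -/
lemma exists_mul_eq_mul_diagonal_of_pow_eq_one {n : Type*} [Fintype n] [DecidableEq n]
    (M : Matrix n n ℂ) {k : ℕ} (hk : k ≠ 0) (hM : M ^ k = 1) :
    ∃ (P : Matrix n n ℂ) (d : n → ℂ), IsUnit P ∧ M * P = P * diagonal d := by
  have hss : Module.End.IsSemisimple (Matrix.toLin' M) := by
    refine Module.End.isSemisimple_of_squarefree_aeval_eq_zero (p := Polynomial.X ^ k - 1) ?_ ?_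
    · exact (Polynomial.separable_X_pow_sub_C (1 : ℂ) (by exact_mod_cast hk) one_ne_zero).squarefree
    · simp [← Matrix.toLin'_pow, hM, Module.End.one_eq_id]
  let S : Set (n → ℂ) := {v | ∃ a : ℂ, M *ᵥ v = a • v}
  have hS : Submodule.span ℂ S = ⊤ := by
    rw [eq_top_iff, ← hss.iSup_eigenspace_eq_top]
    refine iSup_le fun a v hv => Submodule.subset_span ⟨a, ?_⟩
    simpa using Module.End.mem_eigenspace_iff.mp hv
  obtain ⟨b, hbS, hbspan, hbli⟩ := exists_linearIndependent ℂ S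
  let B : Module.Basis b ℂ (n → ℂ) := Module.Basis.mk hbli (by simp [hbspan, hS])
  let e : b ≃ n := B.indexEquiv (Pi.basisFun ℂ n)
  have hv (i : n) : ∃ a : ℂ, M *ᵥ (e.symm i : n → ℂ) = a • (e.symm i : n → ℂ) :=
    hbS (e.symm i).2
  choose d hd using hv
  refine ⟨of fun i j => (e.symm j : n → ℂ) i, d, ?_, ?_⟩
  · rw [← Matrix.linearIndependent_cols_iff_isUnit]
    exact hbli.comp e.symm e.symm.injective
  · ext i j
    rw [mul_diagonal]
    have := congrFun (hd j) i
    simpa [Matrix.mul_apply, Matrix.mulVec, dotProduct, mul_comm] using this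

/-- The sum of `a ^ i * b ^ j` over `i + j < m`. -/
noncomputable def triangleSum (a b : ℂ) (m : ℕ) : ℂ :=
  ∑ i ∈ Finset.range m, a ^ i * ∑ j ∈ Finset.range (m - i), b ^ j

lemma triangleSum_one_one_add_succ (m : ℕ) :
    triangleSum 1 1 m + triangleSum 1 1 (m + 1) = (m + 1) ^ 2 := by
  have h (k : ℕ) : triangleSum 1 1 k = k * (k + 1) / 2 := by
    have h₁ : triangleSum 1 1 k = ∑ i ∈ Finset.range k, ((i : ℂ) + 1) := by
      rw [← Finset.sum_range_reflect]
      simp only [triangleSum, one_pow, one_mul, Finset.sum_const, Finset.card_range, nsmul_eq_mul,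
        mul_one]
      refine Finset.sum_congr rfl fun i hi => ?_
      have := Finset.mem_range.mp hi
      rw [show k - i = (k - 1 - i) + 1 by omega]
      push_cast
      rfl
    rw [h₁]
    clear h₁
    induction k with
    | zero => simp
    | succ k ih => rw [Finset.sum_range_succ, ih]; push_cast; ring
  rw [h, h]
  push_cast
  ring

lemma sum_inv_pow_eq_sum_pow {c : ℂ} {m : ℕ} (hc : c ^ m = 1) :
    ∑ i ∈ Finset.range m, c⁻¹ ^ i = ∑ i ∈ Finset.range m, c ^ i := by
  rcases eq_or_ne c 1 with rfl | h
  · simp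
  · rw [geom_sum_eq h, geom_sum_eq (by simpa using h), inv_pow, hc]
    simp

lemma one_sub_mul_triangleSum (a b : ℂ) (m : ℕ) :
    (1 - b) * triangleSum a b m =
      ∑ i ∈ Finset.range m, a ^ i - ∑ i ∈ Finset.range m, a ^ i * b ^ (m - i) := by
  rw [triangleSum, Finset.mul_sum, ← Finset.sum_sub_distrib]
  refine Finset.sum_congr rfl fun i _ => ?_
  rw [mul_left_comm, mul_neg_geom_sum]
  ring

lemma triangleSum_add_triangleSum_inv_succ {a b : ℂ} {m : ℕ} (ha : a ^ m = 1) (hb : b ^ m = 1)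
    (ha1 : a ≠ 1) (hb1 : b ≠ 1) :
    triangleSum a b m + triangleSum a⁻¹ b⁻¹ (m + 1) = 1 := by
  rcases Nat.eq_zero_or_pos m with rfl | hm
  · simp [triangleSum]
  have ha0 : a ≠ 0 := by rintro rfl; simp [hm.ne'] at ha
  have hb0 : b ≠ 0 := by rintro rfl; simp [hm.ne'] at hb
  have hai1 : a⁻¹ ≠ 1 := by simpa using ha1
  have h₁ : (1 - b) * triangleSum a b m = - ∑ i ∈ Finset.range m, (a * b⁻¹) ^ i := by
    rw [one_sub_mul_triangleSum, geom_sum_eq ha1, ha, sub_self, zero_div, zero_sub]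
    congr 1
    refine Finset.sum_congr rfl fun i hi => ?_
    rw [pow_sub₀ _ hb0 (Finset.mem_range.mp hi).le, hb, mul_pow, inv_pow, one_mul]
  have h₂ : (1 - b⁻¹) * triangleSum a⁻¹ b⁻¹ (m + 1) =
      1 - b⁻¹ * (∑ i ∈ Finset.range m, (a * b⁻¹)⁻¹ ^ i + 1) := by
    rw [one_sub_mul_triangleSum, Finset.sum_range_succ, geom_sum_eq hai1, inv_pow, ha, inv_one,
      sub_self, zero_div, zero_add, Finset.sum_range_succ, mul_add, Finset.mul_sum]
    congr 2
    · refine Finset.sum_congr rfl fun i hi => ?_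
      have hi' := (Finset.mem_range.mp hi).le
      rw [Nat.sub_add_comm hi', pow_succ, pow_sub₀ _ (inv_ne_zero hb0) hi', inv_pow b m, hb]
      simp only [mul_inv, inv_inv, mul_pow, inv_pow, one_mul, inv_one]
      ring
    · simp [ha]
  rw [sum_inv_pow_eq_sum_pow (by rw [mul_pow, inv_pow, ha, hb]; simp)] at h₂
  have hb1' : 1 - b ≠ 0 := sub_ne_zero.mpr hb1.symm
  apply mul_left_cancel₀ hb1'
  have h₃ : (1 - b) = -b * (1 - b⁻¹) := by field_simp; ring
  rw [mul_add, h₁]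
  conv_lhs => rw [h₃, mul_assoc, h₂]
  field_simp
  ring

lemma actPoly_X (M : Matrix (Fin 2) (Fin 2) ℂ) (i : Fin 2) :
    actPoly M (X i) = ∑ j : Fin 2, C (M i j) * X j := by
  simp [actPoly]

lemma actPoly_one : actPoly 1 = AlgHom.id ℂ _ := by
  ext1 i
  simp [actPoly_X, Matrix.one_apply]

lemma actPoly_mul (M N : Matrix (Fin 2) (Fin 2) ℂ) :
    actPoly (M * N) = (actPoly N).comp (actPoly M) := by
  ext1 i
  simp only [actPoly_X, Matrix.mul_apply, AlgHom.comp_apply, map_mul, algHom_C,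
    Fin.sum_univ_two, map_add, MvPolynomial.algebraMap_eq]
  ring

lemma actPoly_diagonal_monomial (d : Fin 2 → ℂ) (s : Fin 2 →₀ ℕ) (r : ℂ) :
    actPoly (Matrix.diagonal d) (monomial s r) = (d 0 ^ s 0 * d 1 ^ s 1) • monomial s r := by
  rw [monomial_eq, smul_eq_C_mul]
  simp only [map_mul, Finsupp.prod_fintype, pow_zero, implies_true, Fin.prod_univ_two, map_pow,
    actPoly_X, Fin.sum_univ_two, algHom_C, MvPolynomial.algebraMap_eq]
  simp
  ring

/-- Polynomials of total degree `< m`. -/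
noncomputable abbrev polyLT (m : ℕ) : Submodule ℂ (MvPolynomial (Fin 2) ℂ) :=
  ⨆ i ∈ Finset.range m, homogeneousSubmodule (Fin 2) ℂ i

lemma polyLT_eq_restrictSupport (m : ℕ) :
    polyLT m = restrictSupport ℂ {s : Fin 2 →₀ ℕ | s 0 + s 1 < m} := by
  apply le_antisymm
  · refine iSup₂_le fun i hi p hp => ?_
    rw [mem_restrictSupport_iff]
    intro s hs
    have := (mem_homogeneousSubmodule i p).mp hp (mem_support_iff.mp hs)
    simp [Finsupp.weight_apply, Finsupp.sum_fintype] at this hi ⊢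
    omega
  · rw [restrictSupport_eq_span, Submodule.span_le]
    rintro _ ⟨s, hs, rfl⟩
    refine Submodule.mem_iSup_of_mem (s 0 + s 1) (Submodule.mem_iSup_of_mem (by simpa using hs) ?_)
    exact isHomogeneous_monomial _ (by simp [Finsupp.degree_eq_sum])

lemma actPoly_mem_polyLT (M : Matrix (Fin 2) (Fin 2) ℂ) (m : ℕ) :
    ∀ p ∈ polyLT m, (actPoly M).toLinearMap p ∈ polyLT m := by
  change polyLT m ≤ (polyLT m).comap (actPoly M).toLinearMap
  refine iSup₂_le fun i hi p hp => ?_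
  refine Submodule.mem_iSup_of_mem i (Submodule.mem_iSup_of_mem hi ?_)
  have hp' : p.IsHomogeneous i := hp
  have : (actPoly M p).IsHomogeneous (1 * i) := by
    refine hp'.aeval _ fun j => IsHomogeneous.sum _ _ _ fun k _ => ?_
    simpa using (isHomogeneous_C _ _).mul (isHomogeneous_X ℂ k)
  simpa using this

/-- The action of a matrix on polynomials of total degree `< m`. -/
noncomputable def actPolyLT (m : ℕ) (M : Matrix (Fin 2) (Fin 2) ℂ) : Module.End ℂ (polyLT m) :=
  (actPoly M).toLinearMap.restrict (actPoly_mem_polyLT M m)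

lemma actPolyLT_one (m : ℕ) : actPolyLT m 1 = 1 := by
  ext1 p
  apply Subtype.ext
  simp [actPolyLT, actPoly_one]

lemma actPolyLT_mul (m : ℕ) (M N : Matrix (Fin 2) (Fin 2) ℂ) :
    actPolyLT m (M * N) = actPolyLT m N * actPolyLT m M := by
  ext1 p
  apply Subtype.ext
  simp [actPolyLT, actPoly_mul]

/-- Pairs of exponents with sum `< m`, arranged by rows. -/
noncomputable def exponentEquiv (m : ℕ) :
    {s : Fin 2 →₀ ℕ | s 0 + s 1 < m} ≃ Σ i : Fin m, Fin (m - i) where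
  toFun s := ⟨⟨s.1 0, by have := s.2; simp only [Set.mem_ofPred_eq] at this; omega⟩,
    ⟨s.1 1, by have := s.2; simp only [Set.mem_ofPred_eq] at this ⊢; omega⟩⟩
  invFun p := ⟨Finsupp.equivFunOnFinite.symm ![p.1, p.2], by
    have := p.2.2
    simp
    omega⟩
  left_inv s := by
    apply Subtype.ext
    ext i
    fin_cases i <;> simp
  right_inv p := by simp

instance (m : ℕ) : Finite {s : Fin 2 →₀ ℕ | s 0 + s 1 < m} := .of_equiv _ (exponentEquiv m).symm

instance (m : ℕ) : FiniteDimensional ℂ (polyLT m) := by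
  rw [polyLT_eq_restrictSupport]
  exact .of_basis (basisRestrictSupport ℂ _)

lemma trace_actPolyLT_diagonal (m : ℕ) (d : Fin 2 → ℂ) :
    LinearMap.trace ℂ _ (actPolyLT m (Matrix.diagonal d)) = triangleSum (d 0) (d 1) m := by
  let e := LinearEquiv.ofEq _ _ (polyLT_eq_restrictSupport m)
  let b := (basisRestrictSupport ℂ {s : Fin 2 →₀ ℕ | s 0 + s 1 < m}).map e.symm
  let b' := b.reindex (exponentEquiv m)
  have hb (s) : (b s : MvPolynomial (Fin 2) ℂ) = monomial s.1 1 := by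
    have : b s = e.symm ⟨monomial s.1 1, (monomial_mem_restrictSupport ℂ).mpr (.inl s.2)⟩ := by
      rw [Module.Basis.apply_eq_iff]
      ext t
      simp only [b, Module.Basis.map_repr, LinearEquiv.trans_apply, LinearEquiv.symm_symm,
        LinearEquiv.apply_symm_apply]
      change coeff t.1 (monomial s.1 (1 : ℂ)) = _
      simp [Finsupp.single_apply, Subtype.ext_iff]
    rw [this]
    rfl
  have hb' (p) : actPolyLT m (Matrix.diagonal d) (b' p) =
      (d 0 ^ (p.1 : ℕ) * d 1 ^ (p.2 : ℕ)) • b' p := by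
    apply Subtype.ext
    simp only [actPolyLT, b', LinearMap.coe_restrict_apply, Module.Basis.reindex_apply, hb,
      Submodule.coe_smul, AlgHom.toLinearMap_apply, actPoly_diagonal_monomial]
    simp [exponentEquiv]
  rw [LinearMap.trace_eq_matrix_trace ℂ b', Matrix.trace]
  simp only [Matrix.diag_apply, LinearMap.toMatrix_apply, hb', map_smul, Finsupp.smul_apply,
    Module.Basis.repr_self, Finsupp.single_eq_same, smul_eq_mul, mul_one]
  rw [Fintype.sum_sigma, triangleSum, ← Fin.sum_univ_eq_sum_range
    (fun i => d 0 ^ i * ∑ j ∈ Finset.range (m - i), d 1 ^ j)]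
  refine Finset.sum_congr rfl fun i _ => ?_
  rw [← Fin.sum_univ_eq_sum_range (fun j => d 1 ^ j), Finset.mul_sum]

lemma trace_actPolyLT_of_mul_eq (m : ℕ) {M P : Matrix (Fin 2) (Fin 2) ℂ} {d : Fin 2 → ℂ}
    (hP : IsUnit P) (h : M * P = P * Matrix.diagonal d) :
    LinearMap.trace ℂ _ (actPolyLT m M) = triangleSum (d 0) (d 1) m := by
  obtain ⟨u, rfl⟩ := hP
  have hM : M = u * Matrix.diagonal d * (↑u⁻¹ : Matrix (Fin 2) (Fin 2) ℂ) := by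
    rw [← h, mul_assoc, Units.mul_inv, mul_one]
  rw [hM, actPolyLT_mul, LinearMap.trace_mul_comm, ← actPolyLT_mul, ← mul_assoc,
    Units.inv_mul, one_mul, trace_actPolyLT_diagonal]

/-- The representation of `G` on polynomials of total degree `< m`. -/
noncomputable def polyRep (G : Subgroup (GL (Fin 2) ℂ)) (m : ℕ) :
    Representation ℂ G (polyLT m) where
  toFun g := actPolyLT m (g⁻¹ : G).1.1
  map_one' := by simp [actPolyLT_one]
  map_mul' g h := by simp [actPolyLT_mul]

lemma coe_polyRep_apply (G : Subgroup (GL (Fin 2) ℂ)) (m : ℕ) (g : G) (p : polyLT m) :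
    (polyRep G m g p : MvPolynomial (Fin 2) ℂ) = actPoly (g⁻¹ : G).1.1 p :=
  rfl

lemma mem_invPoly {G : Subgroup (GL (Fin 2) ℂ)} {p : MvPolynomial (Fin 2) ℂ} :
    p ∈ invPoly G ↔ ∀ g ∈ G, actPoly g.1 p = p := by
  simp only [invPoly, Submodule.mem_iInf, LinearMap.mem_ker, LinearMap.sub_apply, sub_eq_zero]
  rfl

lemma dInv_eq_finrank_invariants (G : Subgroup (GL (Fin 2) ℂ)) (m : ℕ) :
    dInv G m = Module.finrank ℂ (polyRep G m).invariants := by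
  have h : (polyRep G m).invariants = (invPoly G).comap (polyLT m).subtype := by
    ext p
    rw [Representation.mem_invariants, Submodule.mem_comap, mem_invPoly]
    constructor
    · intro hp g hg
      have := congrArg Subtype.val (hp (⟨g, hg⟩⁻¹ : G))
      rwa [coe_polyRep_apply, inv_inv] at this
    · intro hp g
      apply Subtype.ext
      rw [coe_polyRep_apply]
      exact hp (g⁻¹ : G).1 (g⁻¹ : G).2
  rw [h, ← Submodule.finrank_map_subtype_eq, Submodule.map_comap_subtype, inf_comm, dInv]

lemma card_mul_finrank_invariants {K G V : Type*} [Field K] [CharZero K] [Group G] [Fintype G]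
    [AddCommGroup V] [Module K V] [FiniteDimensional K V] (ρ : Representation K G V) :
    (Fintype.card G : K) * Module.finrank K ρ.invariants =
      ∑ g : G, LinearMap.trace K V (ρ g) := by
  have hG : (Fintype.card G : K) ≠ 0 := by exact_mod_cast Fintype.card_ne_zero
  let _ := invertibleOfNonzero hG
  rw [← (Representation.isProj_averageMap ρ).trace, Representation.averageMap,
    GroupAlgebra.average]
  simp only [map_smul, map_sum, smul_eq_mul, mul_invOf_cancel_left', Representation.asAlgebraHom_of]

lemma card_mul_dInv (G : Subgroup (GL (Fin 2) ℂ)) [Fintype G] (m : ℕ) :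
    (Fintype.card G : ℂ) * dInv G m =
      ∑ g : G, LinearMap.trace ℂ _ (actPolyLT m g.1.1) := by
  rw [dInv_eq_finrank_invariants]
  exact (card_mul_finrank_invariants (polyRep G m)).trans
    (Fintype.sum_equiv (Equiv.inv G) _ _ fun g => rfl)

/-- If a finite subgroup `G ⊂ GL(2,ℂ)` acts on `ℂ[x,y]` freely in codimension 1
(no non-identity element has eigenvalue 1), then for every `m` divisible by `|G|`,
`d_m + d_{m+1} = ((m+1)² + |G| − 1)/|G|`. -/
theorem stmt_2 (G : Subgroup (GL (Fin 2) ℂ)) [Finite G]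
    (hfree : ∀ g ∈ G, g ≠ 1 →
      ∀ v : Fin 2 → ℂ, (g : Matrix (Fin 2) (Fin 2) ℂ).mulVec v = v → v = 0)
    (m : ℕ) (hdvd : Nat.card G ∣ m) :
    Nat.card G * (dInv G m + dInv G (m + 1)) = (m + 1) ^ 2 + Nat.card G - 1 := by
  classical
  have := Fintype.ofFinite G
  rw [Nat.card_eq_fintype_card] at hdvd ⊢
  have hcard : 0 < Fintype.card G := Fintype.card_pos
  have key (g : G) : LinearMap.trace ℂ _ (actPolyLT m g.1.1) +
      LinearMap.trace ℂ _ (actPolyLT (m + 1) (g⁻¹ : G).1.1) =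
      1 + if g = 1 then ((m : ℂ) + 1) ^ 2 - 1 else 0 := by
    split_ifs with hg
    · subst hg
      have h1 (k : ℕ) : LinearMap.trace ℂ _ (actPolyLT k 1) = triangleSum 1 1 k := by
        simpa using trace_actPolyLT_diagonal k 1
      simp [h1, triangleSum_one_one_add_succ]
    · have hpow : g.1.1 ^ Fintype.card G = 1 := by
        have : g ^ Fintype.card G = 1 := pow_card_eq_one
        exact congrArg (fun x : G => x.1.1) this
      obtain ⟨P, d, hP, hPd⟩ :=
        exists_mul_eq_mul_diagonal_of_pow_eq_one g.1.1 hcard.ne' hpow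
      have hcol (i : Fin 2) : g.1.1.mulVec (P.col i) = d i • P.col i := by
        ext j
        have := congrFun (congrFun hPd j) i
        rw [Matrix.mul_diagonal] at this
        simpa [Matrix.mul_apply, Matrix.mulVec, dotProduct, mul_comm] using this
      have hd1 (i : Fin 2) : d i ≠ 1 := by
        intro h
        have h0 := hfree g.1 g.2 (by simpa using hg) (P.col i) (by simpa [h] using hcol i)
        exact (Matrix.linearIndependent_cols_iff_isUnit.mpr hP).ne_zero i h0
      have hdpow : Matrix.diagonal d ^ Fintype.card G = 1 := by
        have hconj (k : ℕ) : g.1.1 ^ k * P = P * Matrix.diagonal d ^ k :=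
          ((SemiconjBy.pow_right (show SemiconjBy P (Matrix.diagonal d) g.1.1 from hPd.symm) k)).symm
        have := hconj (Fintype.card G)
        rw [hpow, one_mul] at this
        exact hP.mul_left_cancel (by rw [← this, mul_one])
      have hdm (i : Fin 2) : d i ^ m = 1 := by
        obtain ⟨k, rfl⟩ := hdvd
        rw [pow_mul]
        have := congrFun (congrFun hdpow i) i
        rw [Matrix.diagonal_pow] at this
        simp at this
        simp [this]
      have hd0 (i : Fin 2) : d i ≠ 0 := by
        intro h
        have := congrFun (congrFun hdpow i) i
        rw [Matrix.diagonal_pow] at this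
        simp [h, hcard.ne'] at this
      have hinv : (g⁻¹ : G).1.1 * P = P * Matrix.diagonal d⁻¹ := by
        have h1 : (g⁻¹ : G).1.1 * g.1.1 = 1 := g.1.inv_val
        have h2 : Matrix.diagonal d * Matrix.diagonal d⁻¹ = 1 := by
          simp [Matrix.diagonal_mul_diagonal, hd0]
        calc (g⁻¹ : G).1.1 * P = (g⁻¹ : G).1.1 * (P * Matrix.diagonal d) * Matrix.diagonal d⁻¹ := by
              rw [mul_assoc, mul_assoc P, h2, mul_one]
          _ = P * Matrix.diagonal d⁻¹ := by rw [← hPd, ← mul_assoc, h1, one_mul]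
      rw [trace_actPolyLT_of_mul_eq m hP hPd, trace_actPolyLT_of_mul_eq (m + 1) hP hinv, add_zero]
      exact triangleSum_add_triangleSum_inv_succ (hdm 0) (hdm 1) (hd1 0) (hd1 1)
  have hC : (Fintype.card G : ℂ) * (dInv G m + dInv G (m + 1)) =
      Fintype.card G + (((m : ℂ) + 1) ^ 2 - 1) := by
    rw [mul_add, card_mul_dInv, card_mul_dInv,
      ← Equiv.sum_comp (Equiv.inv G) (fun g : G => LinearMap.trace ℂ _ (actPolyLT (m + 1) g.1.1)),
      ← Finset.sum_add_distrib]
    simp only [Equiv.inv_apply, key]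
    simp [Finset.sum_add_distrib]
  have hN : Fintype.card G * (dInv G m + dInv G (m + 1)) + 1 = (m + 1) ^ 2 + Fintype.card G := by
    have : ((Fintype.card G * (dInv G m + dInv G (m + 1)) + 1 : ℕ) : ℂ) =
        ((m + 1) ^ 2 + Fintype.card G : ℕ) := by
      push_cast
      rw [hC]
      ring
    exact_mod_cast this
  omega
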